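/- Fix k ∈ ℕ and β ∈ (0,1). For each n, let X⃗_n be a multinomial random vector Mult(n, p₁(n), …, p_k(n)) whose category probabilities satisfy, for each i ≤ k−1, Ω(n^{−β}) ≤ p_i(n) ≤ o(1) (i.e., p_i(n) ≥ c_i n^{−β} for some constant c_i > 0 and p_i(n) → 0). Then max_{x⃗} P[X⃗_n = x⃗] = O(n^{−(k−1)(1−β)/2}). -/

import Mathlib

open Filter

/-- The probability mass function of the multinomial distribution `Mult(n, p₁, …, p_k)`
evaluated at a vector of category counts `x`. -/
noncomputable def multinomialProb {k : ℕ} (n : ℕ) (p : Fin k → ℝ) (x : Fin k → ℕ) : ℝ :=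
  if ∑ i, x i = n then (Nat.multinomial Finset.univ x : ℝ) * ∏ i, p i ^ x i else 0

open Real in
/-- The Poisson mass function of parameter `l` is bounded by `1 / √l`. -/
theorem poisson_mass_le_inv_sqrt (x : ℕ) {l : ℝ} (hl : 0 < l) :
    l ^ x * exp (-l) / x.factorial ≤ (√l)⁻¹ := by
  have hf : (0 : ℝ) < x.factorial := by exact_mod_cast x.factorial_pos
  suffices h : l * (l ^ x * exp (-l)) ^ 2 ≤ (x.factorial : ℝ) ^ 2 by
    have hs : 0 < √l := sqrt_pos.mpr hl
    rw [div_le_iff₀ hf, inv_mul_eq_div, le_div_iff₀ hs]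
    refine abs_le_of_sq_le_sq' ?_ hf.le |>.2
    rw [mul_pow, sq_sqrt hl.le]
    linarith
  have hm : (0 : ℝ) < x + 1 / 2 := by positivity
  have key : l ^ (2 * x + 1) * exp (-(2 * l)) ≤
      ((x : ℝ) + 1 / 2) ^ (2 * x + 1) * exp (-(2 * x + 1)) := by
    have h1 : l / (x + 1 / 2) ≤ exp (l / (x + 1 / 2) - 1) := by
      simpa using add_one_le_exp (l / ((x : ℝ) + 1 / 2) - 1)
    have h2 := pow_le_pow_left₀ (by positivity) h1 (2 * x + 1)
    rw [div_pow, div_le_iff₀ (by positivity), ← exp_nat_mul] at h2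
    have h3 : ((2 * x + 1 : ℕ) : ℝ) * (l / (x + 1 / 2) - 1) = 2 * l + -(2 * x + 1) := by
      push_cast
      field_simp
      ring
    rw [h3, exp_add] at h2
    calc l ^ (2 * x + 1) * exp (-(2 * l))
        ≤ (exp (2 * l) * exp (-(2 * x + 1)) * ((x : ℝ) + 1 / 2) ^ (2 * x + 1))
            * exp (-(2 * l)) := by gcongr
      _ = (exp (2 * l) * exp (-(2 * l))) *
            (((x : ℝ) + 1 / 2) ^ (2 * x + 1) * exp (-(2 * x + 1))) := by ring
      _ = _ := by rw [← exp_add]; simp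
  have lhs : l * (l ^ x * exp (-l)) ^ 2 = l ^ (2 * x + 1) * exp (-(2 * l)) := by
    rw [mul_pow, ← exp_nat_mul, ← pow_mul, pow_succ, mul_comm x 2]
    push_cast
    ring_nf
  rw [lhs]
  refine key.trans ?_
  rcases Nat.eq_zero_or_pos x with rfl | hx
  · have : exp (-1) ≤ 1 := exp_le_one_iff.mpr (by norm_num)
    norm_num
    linarith
  have hx1 : (1 : ℝ) ≤ x := by exact_mod_cast hx
  have hx0 : (0 : ℝ) < x := by linarith
  have hpow : ((x : ℝ) + 1 / 2) ^ (2 * x) ≤ x ^ (2 * x) * exp 1 := by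
    have h1 : (x : ℝ) + 1 / 2 ≤ x * exp (1 / (2 * x)) := by
      have := mul_le_mul_of_nonneg_left (add_one_le_exp (1 / (2 * (x : ℝ)))) hx0.le
      refine le_trans (le_of_eq ?_) this
      field_simp
      ring
    have h2 := pow_le_pow_left₀ hm.le h1 (2 * x)
    rw [mul_pow, ← exp_nat_mul] at h2
    rwa [show ((2 * x : ℕ) : ℝ) * (1 / (2 * x)) = 1 by push_cast; field_simp] at h2
  have hst := pow_le_pow_left₀ (by positivity) (Stirling.le_factorial_stirling x) 2
  refine le_trans ?_ hst
  rw [mul_pow, sq_sqrt (by positivity), div_pow, div_pow, ← pow_mul, ← pow_mul, mul_comm x 2,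
    ← exp_nat_mul]
  have he : exp (-(2 * x + 1)) = exp (-1) * (exp (2 * x))⁻¹ := by
    rw [← exp_neg, ← exp_add]
    ring_nf
  have he1 : exp 1 * exp (-1) = 1 := by rw [← exp_add]; simp
  rw [pow_succ, he]
  push_cast
  rw [mul_one]
  have hpi := pi_gt_three
  calc ((x : ℝ) + 1 / 2) ^ (2 * x) * (x + 1 / 2) * (exp (-1) * (exp (2 * x))⁻¹)
      ≤ (x ^ (2 * x) * exp 1) * (2 * π * x) * (exp (-1) * (exp (2 * x))⁻¹) := by
        gcongr
        nlinarith
    _ = (exp 1 * exp (-1)) * (2 * π * x * (x ^ (2 * x) * (exp (2 * x))⁻¹)) := by ring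
    _ = _ := by rw [he1, one_mul, div_eq_mul_inv]

open Real in
/-- The upper half of Stirling's approximation, with an explicit constant. -/
theorem factorial_le_stirling {n : ℕ} (hn : n ≠ 0) :
    (n.factorial : ℝ) ≤ exp 1 * √n * (n / exp 1) ^ n := by
  obtain ⟨m, rfl⟩ := Nat.exists_eq_succ_of_ne_zero hn
  have h := Stirling.stirlingSeq'_antitone (Nat.zero_le m)
  simp only [Function.comp_apply] at h
  rw [Nat.succ_eq_add_one 0, zero_add, Stirling.stirlingSeq_one, Stirling.stirlingSeq,
    div_le_iff₀ (by positivity)] at h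
  refine h.trans (le_of_eq ?_)
  rw [sqrt_mul (by norm_num)]
  field_simp

open Real in
/-- A nonasymptotic bound for the multinomial mass function. -/
theorem multinomialProb_le {k n : ℕ} (hn : n ≠ 0) {p : Fin k → ℝ} (hp : ∀ i, 0 < p i)
    (hsum : ∑ i, p i = 1) (x : Fin k → ℕ) :
    multinomialProb n p x ≤ exp 1 * √n * ∏ i, (√(n * p i))⁻¹ := by
  unfold multinomialProb
  split_ifs with hx
  swap
  · positivity
  have hn0 : (0 : ℝ) < n := by positivity
  have hmult : (∏ i, ((x i).factorial : ℝ)) * Nat.multinomial Finset.univ x = n.factorial := by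
    have := Nat.multinomial_spec Finset.univ x
    rw [hx] at this
    exact_mod_cast this
  have hf : 0 < ∏ i, ((x i).factorial : ℝ) :=
    Finset.prod_pos fun i _ => by exact_mod_cast (x i).factorial_pos
  have hprod : ∏ i, ((n * p i) ^ x i * exp (-(n * p i)) / (x i).factorial) =
      n ^ n * (∏ i, p i ^ x i) * exp (-n) / ∏ i, ((x i).factorial : ℝ) := by
    rw [Finset.prod_div_distrib, Finset.prod_mul_distrib, ← exp_sum, Finset.sum_neg_distrib,
      ← Finset.mul_sum, hsum, mul_one]
    simp only [mul_pow]
    rw [Finset.prod_mul_distrib, Finset.prod_pow_eq_pow_sum, hx]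
  have hpois : ∏ i, ((n * p i) ^ x i * exp (-(n * p i)) / (x i).factorial) ≤
      ∏ i, (√(n * p i))⁻¹ := by
    refine Finset.prod_le_prod (fun i _ => ?_) fun i _ => ?_
    · have := hp i
      positivity
    · exact poisson_mass_le_inv_sqrt (x i) (mul_pos hn0 (hp i))
  have hpx : 0 ≤ ∏ i, p i ^ x i := Finset.prod_nonneg fun i _ => pow_nonneg (hp i).le _
  have hpow : ((n : ℝ) / exp 1) ^ n = n ^ n * exp (-n) := by
    rw [div_pow, ← exp_nat_mul, mul_one, exp_neg, div_eq_mul_inv]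
  calc (Nat.multinomial Finset.univ x : ℝ) * ∏ i, p i ^ x i
      = n.factorial * ((∏ i, p i ^ x i) / ∏ i, ((x i).factorial : ℝ)) := by
        rw [← hmult]
        field_simp
    _ ≤ (exp 1 * √n * (n / exp 1) ^ n) * ((∏ i, p i ^ x i) / ∏ i, ((x i).factorial : ℝ)) := by
        gcongr
        exact factorial_le_stirling hn
    _ = exp 1 * √n * ∏ i, ((n * p i) ^ x i * exp (-(n * p i)) / (x i).factorial) := by
        rw [hprod, hpow]
        ring
    _ ≤ _ := by gcongr

theorem multinomial_mode_bound (k : ℕ) (β : ℝ) (hβ0 : 0 < β) (hβ1 : β < 1)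
    (p : ℕ → Fin k → ℝ)
    (hnonneg : ∀ n i, 0 ≤ p n i) (hsum : ∀ n, ∑ i, p n i = 1)
    (hlower : ∀ i : Fin k, (i : ℕ) < k - 1 →
      ∃ c > 0, ∀ᶠ n : ℕ in atTop, c * (n : ℝ) ^ (-β) ≤ p n i)
    (hupper : ∀ i : Fin k, (i : ℕ) < k - 1 →
      Tendsto (fun n => p n i) atTop (nhds 0)) :
    ∃ C > 0, ∀ᶠ n : ℕ in atTop, ∀ x : Fin k → ℕ,
      multinomialProb n (p n) x ≤ C * (n : ℝ) ^ (-(((k : ℝ) - 1) * (1 - β) / 2)) := by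
  obtain _ | m := k
  · simpa using hsum 0
  choose c hc hlow using fun i : Fin m => hlower i.castSucc (by simp)
  have hup : ∀ i : Fin m, Tendsto (fun n => p n i.castSucc) atTop (nhds 0) :=
    fun i => hupper i.castSucc (by simp)
  have hlast : ∀ᶠ n : ℕ in atTop, 1 / 2 ≤ p n (Fin.last m) := by
    have h0 : Tendsto (fun n => ∑ i : Fin m, p n i.castSucc) atTop (nhds 0) := by
      simpa using tendsto_finsetSum Finset.univ fun i _ => hup i
    filter_upwards [h0.eventually_le_const (by norm_num : (0 : ℝ) < 1 / 2)] with n hn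
    have := hsum n
    rw [Fin.sum_univ_castSucc] at this
    linarith
  refine ⟨Real.exp 1 * √2 * ∏ i, (√(c i))⁻¹, ?_, ?_⟩
  · have : 0 < ∏ i, (√(c i))⁻¹ :=
      Finset.prod_pos fun i _ => inv_pos.mpr (Real.sqrt_pos.mpr (hc i))
    positivity
  filter_upwards [hlast, eventually_all.mpr hlow, eventually_ne_atTop 0] with n hl hcn hn x
  have hn0 : (0 : ℝ) < n := by positivity
  have hpos : ∀ i, 0 < p n i := by
    refine Fin.lastCases (by linarith) fun i => ?_
    exact (mul_pos (hc i) (Real.rpow_pos_of_pos hn0 _)).trans_le (hcn i)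
  refine (multinomialProb_le hn hpos (hsum n) x).trans ?_
  rw [Fin.prod_univ_castSucc]
  have hfactor : ∀ i : Fin m, (√(n * p n i.castSucc))⁻¹ ≤
      (√(c i))⁻¹ * (n : ℝ) ^ (-((1 - β) / 2)) := by
    intro i
    have h1 : c i * (n : ℝ) ^ (1 - β) ≤ n * p n i.castSucc := by
      calc c i * (n : ℝ) ^ (1 - β) = n * (c i * (n : ℝ) ^ (-β)) := by
            rw [sub_eq_add_neg, Real.rpow_add hn0, Real.rpow_one]
            ring
        _ ≤ _ := by gcongr; exact hcn i
    have h2 : √(c i * (n : ℝ) ^ (1 - β)) = √(c i) * (n : ℝ) ^ ((1 - β) / 2) := by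
      rw [Real.sqrt_mul (hc i).le, Real.sqrt_eq_rpow ((n : ℝ) ^ (1 - β)), ← Real.rpow_mul hn0.le]
      ring_nf
    rw [Real.rpow_neg hn0.le, ← mul_inv, ← h2]
    have := hc i
    gcongr
  have hprod : ∏ i : Fin m, (√(n * p n i.castSucc))⁻¹ ≤
      (∏ i, (√(c i))⁻¹) * (n : ℝ) ^ (-((m : ℝ) * (1 - β) / 2)) := by
    refine (Finset.prod_le_prod (fun i _ => by positivity) fun i _ => hfactor i).trans
      (le_of_eq ?_)
    rw [Finset.prod_mul_distrib, Finset.prod_const, Finset.card_univ, Fintype.card_fin,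
      ← Real.rpow_mul_natCast hn0.le]
    ring_nf
  have hlastfactor : √n * (√(n * p n (Fin.last m)))⁻¹ ≤ √2 := by
    rw [← div_eq_mul_inv, ← Real.sqrt_div hn0.le]
    apply Real.sqrt_le_sqrt
    rw [div_le_iff₀ (mul_pos hn0 (hpos _))]
    nlinarith
  push_cast
  rw [add_sub_cancel_right]
  calc Real.exp 1 * √n * ((∏ i : Fin m, (√(n * p n i.castSucc))⁻¹) *
        (√(n * p n (Fin.last m)))⁻¹)
      = Real.exp 1 * (√n * (√(n * p n (Fin.last m)))⁻¹) *
          ∏ i : Fin m, (√(n * p n i.castSucc))⁻¹ := by ring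
    _ ≤ Real.exp 1 * √2 *
          ((∏ i, (√(c i))⁻¹) * (n : ℝ) ^ (-((m : ℝ) * (1 - β) / 2))) := by
        gcongr
    _ = _ := by ring
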